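/- For each γ ∈ {α,β}, M^e_γ(Σ_D) is contained in the weak* closure of M^e_γ(Σ_D) ∩ M^CO(Σ_D), and M^e_0(Σ_D) is contained in the weak* closure of M^e_γ(Σ_D) ∩ M^CO(Σ_D). In particular, M^CO(Σ_D) is dense in M^e(Σ_D). -/

import Mathlib

open MeasureTheory Topology Filter
open scoped ENNReal NNReal


/-! ### The alphabet of the (M,N) Dyck–Motzkin shift -/

/-- The alphabet `D = D_α ∪ D_0 ∪ D_β` of the `(M,N)` Dyck–Motzkin shift:
`la k` is the left bracket `α_k`, `u k` is the unit `1_k`, `ra k` is the right bracket `β_k`. -/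
inductive DMSym (M N : ℕ) : Type where
  | la : Fin M → DMSym M N
  | u  : Fin N → DMSym M N
  | ra : Fin M → DMSym M N
deriving DecidableEq

namespace DMSym

def equivSum (M N : ℕ) : DMSym M N ≃ (Fin M ⊕ Fin N ⊕ Fin M) where
  toFun s := match s with
    | .la k => Sum.inl k
    | .u k => Sum.inr (Sum.inl k)
    | .ra k => Sum.inr (Sum.inr k)
  invFun s := match s with
    | Sum.inl k => .la k
    | Sum.inr (Sum.inl k) => .u k
    | Sum.inr (Sum.inr k) => .ra k
  left_inv s := by cases s <;> rfl
  right_inv s := by rcases s with k | k | k <;> rfl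

instance (M N : ℕ) : Fintype (DMSym M N) := Fintype.ofEquiv _ (equivSum M N).symm
instance (M N : ℕ) : TopologicalSpace (DMSym M N) := ⊥
instance (M N : ℕ) : DiscreteTopology (DMSym M N) := ⟨rfl⟩
instance (M N : ℕ) : MeasurableSpace (DMSym M N) := ⊤
instance (M N : ℕ) : BorelSpace (DMSym M N) := ⟨borel_eq_top_of_discrete.symm⟩

end DMSym

/-- Nonzero elements of the Dyck–Motzkin monoid with zero are represented in normal form:
`some (bs, as)` is the reduced word `β_{bs(0)} ⋯ β_{bs(r)} α_{as(0)} ⋯ α_{as(s)}`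
(in particular `some ([], [])` is the unit element `1`); `none` is the zero element `0`. -/
abbrev DyckElem (M : ℕ) := Option (List (Fin M) × List (Fin M))

/-- Multiplication, in the Dyck–Motzkin monoid with zero, of an element in normal form on
the right by a generator: units are absorbed, a left bracket is appended, and a right bracket
either closes the last left bracket (if the indices match), is appended (if there is no left
bracket to close), or produces the zero element (if the indices do not match). -/
def dyckStep {M N : ℕ} : DyckElem M → DMSym M N → DyckElem M
  | none, _ => none
  | some (bs, as), .la k => some (bs, as ++ [k])
  | some (bs, as), .u _ => some (bs, as)
  | some (bs, as), .ra k =>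
      match as.getLast? with
      | none => some (bs ++ [k], [])
      | some j => if j = k then some (bs, as.dropLast) else none

/-- `red w` is the image of the word `w` in the Dyck–Motzkin monoid with zero. -/
def red {M N : ℕ} (w : List (DMSym M N)) : DyckElem M :=
  w.foldl dyckStep (some ([], []))

/-- The word `x_j x_{j+1} ⋯ x_k` read off a bi-infinite sequence `x`. -/
def wordAt {M N : ℕ} (x : ℤ → DMSym M N) (j k : ℤ) : List (DMSym M N) :=
  (List.range (k + 1 - j).toNat).map fun n => x (j + n)

/-- The `(M,N)` Dyck–Motzkin shift `Σ_D`. -/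
def SigmaD (M N : ℕ) : Set (ℤ → DMSym M N) :=
  {x | ∀ j k : ℤ, j < k → red (wordAt x j k) ≠ none}

/-- The left shift `σ`. -/
def shift {A : Type*} : (ℤ → A) → (ℤ → A) := fun x i => x (i + 1)

/-- The inverse `σ⁻¹` of the left shift. -/
def shiftInv {A : Type*} : (ℤ → A) → (ℤ → A) := fun x i => x (i - 1)

lemma wordAt_shift {M N : ℕ} (x : ℤ → DMSym M N) (j k : ℤ) :
    wordAt (shift x) j k = wordAt x (j + 1) (k + 1) := by
  simp only [wordAt, shift]
  rw [show (k + 1 + 1 - (j + 1) : ℤ) = k + 1 - j by ring]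
  exact List.map_congr_left fun n _ => by rw [show (j + n + 1 : ℤ) = j + 1 + n by ring]

lemma shift_mem_SigmaD {M N : ℕ} {x : ℤ → DMSym M N} (hx : x ∈ SigmaD M N) :
    shift x ∈ SigmaD M N := by
  intro j k hjk
  rw [wordAt_shift]
  exact hx (j + 1) (k + 1) (by omega)

/-- The left shift acting on `Σ_D`. -/
def shiftD (M N : ℕ) : ↥(SigmaD M N) → ↥(SigmaD M N) :=
  fun x => ⟨shift x.val, shift_mem_SigmaD x.property⟩

section Generic
variable {X : Type*} [MeasurableSpace X]

/-- The set of `T`-invariant Borel probability measures. -/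
def InvMeas (T : X → X) : Set (ProbabilityMeasure X) :=
  {μ | MeasurePreserving T μ.toMeasure μ.toMeasure}

/-- The set of `T`-invariant ergodic Borel probability measures. -/
def ErgMeas (T : X → X) : Set (ProbabilityMeasure X) :=
  {μ | Ergodic T μ.toMeasure}

/-- A `CO`-measure: an invariant ergodic probability measure supported on the orbit of a
single periodic point. -/
def IsCOMeas (T : X → X) (μ : ProbabilityMeasure X) : Prop :=
  Ergodic T μ.toMeasure ∧
    ∃ (x : X) (n : ℕ), 0 < n ∧ T^[n] x = x ∧
      μ.toMeasure {y | ∃ k : ℕ, y = T^[k] x} = 1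

/-- Convexity for a set of probability measures: it is stable under taking the convex
combination `t•μ + (1-t)•ν` of any two of its members. -/
def ConvexMeasSet (U : Set (ProbabilityMeasure X)) : Prop :=
  ∀ μ ∈ U, ∀ ν ∈ U, ∀ t : ℝ≥0∞, t ≤ 1 → ∀ ρ : ProbabilityMeasure X,
    ρ.toMeasure = t • μ.toMeasure + (1 - t) • ν.toMeasure → ρ ∈ U

/-- A measure is fully supported if it gives positive measure to every non-empty open set. -/
def FullSupp [TopologicalSpace X] (μ : ProbabilityMeasure X) : Prop :=
  ∀ U : Set X, IsOpen U → U.Nonempty → 0 < μ.toMeasure U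

/-- Measure-theoretic isomorphism of the measure-preserving systems `(X,T,μ)` and `(Y,S,ν)`. -/
def MeasureIso {Y : Type*} [MeasurableSpace Y] (T : X → X) (S : Y → Y)
    (μ : Measure X) (ν : Measure Y) : Prop :=
  ∃ (φ : X → Y) (ψ : Y → X), Measurable φ ∧ Measurable ψ ∧
    Measure.map φ μ = ν ∧ Measure.map ψ ν = μ ∧
    (∀ᵐ x ∂μ, ψ (φ x) = x) ∧ (∀ᵐ y ∂ν, φ (ψ y) = y) ∧
    (∀ᵐ x ∂μ, φ (T x) = S (φ x))

/-- The system `(X,T,μ)` is Bernoulli: it is measure-theoretically isomorphic to a two-sided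
Bernoulli shift, i.e. the left shift on `ℤ → ℕ` equipped with an i.i.d. product measure
(determined by requiring that the measures of all cylinder sets factorize according to a
fixed distribution `p`). -/
def IsBernoulli (T : X → X) (μ : Measure X) : Prop :=
  ∃ (p : ℕ → ℝ≥0∞) (ν : Measure (ℤ → ℕ)), (∑' n, p n) = 1 ∧
    IsProbabilityMeasure ν ∧
    (∀ (n : ℕ) (w : Fin n → ℕ) (j : ℤ),
      ν {y | ∀ i : Fin n, y (j + (i : ℕ)) = w i} = ∏ i, p (w i)) ∧
    MeasureIso T shift μ ν

end Generic

/-- `M(Σ_D)`: the space of shift-invariant Borel probability measures on `Σ_D`,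
endowed with the weak* topology. -/
def MinvD (M N : ℕ) : Set (ProbabilityMeasure ↥(SigmaD M N)) := InvMeas (shiftD M N)

/-- `M^e(Σ_D)`: the shift-invariant ergodic Borel probability measures on `Σ_D`. -/
def MergD (M N : ℕ) : Set (ProbabilityMeasure ↥(SigmaD M N)) := ErgMeas (shiftD M N)

/-- The integral `∫ f dμ`. -/
noncomputable def intCf {M N : ℕ} (f : C(↥(SigmaD M N), ℝ))
    (μ : ProbabilityMeasure ↥(SigmaD M N)) : ℝ := ∫ x, f x ∂μ.toMeasure

/-- `M_max(f)`: the set of `f`-maximizing measures, i.e. the shift-invariant measures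
attaining `sup { ∫ f dν : ν ∈ M(Σ_D) }`. -/
def Mmax (M N : ℕ) (f : C(↥(SigmaD M N), ℝ)) : Set (ProbabilityMeasure ↥(SigmaD M N)) :=
  {μ ∈ MinvD M N | ∀ ν ∈ MinvD M N, intCf f ν ≤ intCf f μ}

/-- `G_j(x)`: `1` on left brackets, `-1` on right brackets, `0` on units. -/
def Gfun {M N : ℕ} (x : ℤ → DMSym M N) (j : ℤ) : ℤ :=
  match x j with
  | .la _ => 1
  | .u _ => 0
  | .ra _ => -1

/-- `H_i(x) = Σ_{j=0}^{i-1} G_j(x)` for `i ≥ 1`, `H_i(x) = -Σ_{j=i}^{-1} G_j(x)` for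
`i ≤ -1`, and `H_0(x) = 0`. -/
def Hfun {M N : ℕ} (x : ℤ → DMSym M N) (i : ℤ) : ℤ :=
  if 0 ≤ i then ∑ j ∈ Finset.range i.toNat, Gfun x (j : ℤ)
  else -∑ j ∈ Finset.range (-i).toNat, Gfun x (i + (j : ℤ))

/-- The set `A_0`. -/
def A0set (M N : ℕ) : Set (ℤ → DMSym M N) :=
  SigmaD M N ∩ {x | ∀ i : ℤ,
    (∃ j : ℕ, 1 ≤ j ∧ Hfun x (i + (j : ℤ)) = Hfun x i) ∧
    (∃ j : ℕ, 1 ≤ j ∧ Hfun x (i - (j : ℤ)) = Hfun x i)}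

/-- The set `A_α`. -/
def AalphaSet (M N : ℕ) : Set (ℤ → DMSym M N) :=
  SigmaD M N ∩ {x | Tendsto (Hfun x) atTop atTop ∧ Tendsto (Hfun x) atBot atBot}

/-- The set `A_β`. -/
def AbetaSet (M N : ℕ) : Set (ℤ → DMSym M N) :=
  SigmaD M N ∩ {x | Tendsto (Hfun x) atTop atBot ∧ Tendsto (Hfun x) atBot atTop}

/-- `M^{CO}(Σ_D)`: the set of `CO`-measures on `Σ_D`. -/
def MCO (M N : ℕ) : Set (ProbabilityMeasure ↥(SigmaD M N)) :=
  {μ | IsCOMeas (shiftD M N) μ}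

/-- `M^e_0(Σ_D) = { μ ∈ M^e(Σ_D) : μ(A_0) = 1 }`. -/
def Me0 (M N : ℕ) : Set (ProbabilityMeasure ↥(SigmaD M N)) :=
  {μ ∈ MergD M N | μ.toMeasure (Subtype.val ⁻¹' A0set M N) = 1}

/-- `M^e_α(Σ_D) = { μ ∈ M^e(Σ_D) : μ(A_α) = 1 }`. -/
def MeAl (M N : ℕ) : Set (ProbabilityMeasure ↥(SigmaD M N)) :=
  {μ ∈ MergD M N | μ.toMeasure (Subtype.val ⁻¹' AalphaSet M N) = 1}

/-- `M^e_β(Σ_D) = { μ ∈ M^e(Σ_D) : μ(A_β) = 1 }`. -/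
def MeBe (M N : ℕ) : Set (ProbabilityMeasure ↥(SigmaD M N)) :=
  {μ ∈ MergD M N | μ.toMeasure (Subtype.val ⁻¹' AbetaSet M N) = 1}


/-- Running maximum of the Birkhoff sums `S_0, ..., S_n`. -/
noncomputable def maxSum {X : Type*} (T : X → X) (f : X → ℝ) : ℕ → X → ℝ
  | 0, _ => 0
  | n + 1, x => max 0 (f x + maxSum T f n (T x))

lemma maxSum_nonneg {X : Type*} (T : X → X) (f : X → ℝ) (n : ℕ) (x : X) :
    0 ≤ maxSum T f n x := by
  cases n with
  | zero => exact le_rfl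
  | succ n => exact le_max_left _ _

lemma maxSum_le_succ {X : Type*} (T : X → X) (f : X → ℝ) (n : ℕ) :
    ∀ x : X, maxSum T f n x ≤ maxSum T f (n + 1) x := by
  induction n with
  | zero => intro x; exact maxSum_nonneg T f 1 x
  | succ n ih =>
    intro x
    exact max_le_max le_rfl (by linarith [ih (T x)])

lemma birkhoffSum_le_maxSum {X : Type*} (T : X → X) (f : X → ℝ) (n : ℕ) :
    ∀ x : X, birkhoffSum T f n x ≤ maxSum T f n x := by
  induction n with
  | zero => intro x; simp [maxSum]
  | succ n ih =>
    intro x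
    rw [birkhoffSum_succ']
    exact le_max_of_le_right (by linarith [ih (T x)])

lemma maxSum_le {X : Type*} (T : X → X) (f : X → ℝ) (C : ℝ) (hC : ∀ x, |f x| ≤ C) (n : ℕ) :
    ∀ x : X, maxSum T f n x ≤ n * C := by
  induction n with
  | zero => intro x; simp [maxSum]
  | succ n ih =>
    intro x
    have h1 := ih (T x)
    have h2 := abs_le.1 (hC x)
    have h3 : 0 ≤ C := (abs_nonneg _).trans (hC x)
    refine max_le (by positivity) ?_
    push_cast
    linarith

lemma measurable_maxSum {X : Type*} [MeasurableSpace X] {T : X → X} {f : X → ℝ}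
    (hT : Measurable T) (hf : Measurable f) (n : ℕ) : Measurable (maxSum T f n) := by
  induction n with
  | zero => exact measurable_const
  | succ n ih => exact measurable_const.max (hf.add (ih.comp hT))

lemma measurable_birkhoffSum' {X : Type*} [MeasurableSpace X] {T : X → X} {f : X → ℝ}
    (hT : Measurable T) (hf : Measurable f) (n : ℕ) : Measurable (birkhoffSum T f n) := by
  unfold birkhoffSum
  exact Finset.measurable_sum _ fun i _ => hf.comp (hT.iterate i)

lemma maximal_ineq {X : Type*} [MeasurableSpace X] {μ : Measure X} [IsProbabilityMeasure μ]
    {T : X → X} (hT : MeasurePreserving T μ μ) {f : X → ℝ} (hf : Measurable f) {C : ℝ}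
    (hC : ∀ x, |f x| ≤ C) (n : ℕ) :
    0 ≤ ∫ x, Set.indicator {x | 0 < maxSum T f n x} f x ∂μ := by
  have hm := measurable_maxSum hT.measurable hf
  have hMint : ∀ n, Integrable (maxSum T f n) μ := fun n => by
    refine Integrable.of_bound (hm n).aestronglyMeasurable (n * C) (ae_of_all _ fun x => ?_)
    rw [Real.norm_eq_abs, abs_of_nonneg (maxSum_nonneg _ _ _ _)]
    exact maxSum_le T f C hC n x
  have hcomp : Integrable (fun x => maxSum T f n (T x)) μ := hT.integrable_comp_of_integrable (hMint n)
  have heq : ∫ x, maxSum T f n (T x) ∂μ = ∫ x, maxSum T f n x ∂μ := by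
    have h := integral_map (μ := μ) hT.measurable.aemeasurable (f := maxSum T f n)
      (hm n).aestronglyMeasurable
    rw [hT.map_eq] at h
    exact h.symm
  have hfi : Integrable f μ := Integrable.of_bound hf.aestronglyMeasurable C (ae_of_all _ hC)
  have : ∫ x, (maxSum T f n x - maxSum T f n (T x)) ∂μ
      ≤ ∫ x, Set.indicator {x | 0 < maxSum T f n x} f x ∂μ := by
    refine integral_mono ((hMint n).sub hcomp)
      (hfi.indicator (measurableSet_lt measurable_const (hm n))) fun x => ?_
    by_cases hx : 0 < maxSum T f n x
    · simp only [Set.indicator, Set.mem_ofPred_eq, hx, if_true]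
      cases n with
      | zero => simp [maxSum] at hx
      | succ n =>
        have h1 := maxSum_le_succ T f n (T x)
        have h2 : maxSum T f (n + 1) x = f x + maxSum T f n (T x) := by
          rcases max_choice 0 (f x + maxSum T f n (T x)) with h | h
          · exfalso; have : maxSum T f (n + 1) x = 0 := h
            linarith
          · exact h
        linarith
    · simp only [Set.indicator, Set.mem_ofPred_eq, hx, if_false]
      linarith [maxSum_nonneg T f n (T x)]
  rw [integral_sub (hMint n) hcomp, heq, sub_self] at this
  exact this

lemma integral_nonneg_of_exists_pos {X : Type*} [MeasurableSpace X] {μ : Measure X}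
    [IsProbabilityMeasure μ]
    {T : X → X} (hT : MeasurePreserving T μ μ) {f : X → ℝ} (hf : Measurable f) {C : ℝ}
    (hC : ∀ x, |f x| ≤ C) (h : ∀ᵐ x ∂μ, ∃ n, 0 < birkhoffSum T f n x) :
    0 ≤ ∫ x, f x ∂μ := by
  have hm := measurable_maxSum hT.measurable hf
  have hlim : Tendsto (fun n => ∫ x, Set.indicator {x | 0 < maxSum T f n x} f x ∂μ) atTop
      (𝓝 (∫ x, f x ∂μ)) := by
    refine tendsto_integral_of_dominated_convergence (fun _ => C) (fun n => ?_)
      (integrable_const C) (fun n => ae_of_all _ fun x => ?_) ?_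
    · exact (hf.indicator (measurableSet_lt measurable_const (hm n))).aestronglyMeasurable
    · exact (norm_indicator_le_norm_self f x).trans (hC x)
    · filter_upwards [h] with x ⟨n, hn⟩
      refine tendsto_const_nhds.congr' ?_
      filter_upwards [eventually_ge_atTop n] with m hm
      have : 0 < maxSum T f m x :=
        (hn.trans_le (birkhoffSum_le_maxSum T f n x)).trans_le
          (monotone_nat_of_le_succ (f := fun n => maxSum T f n x)
            (fun n => maxSum_le_succ T f n x) hm)
      simp [Set.indicator, this]
  exact ge_of_tendsto' hlim fun n => maximal_ineq hT hf hC n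

lemma birkhoffSum_add_const {X : Type*} (T : X → X) (f : X → ℝ) (c : ℝ) (n : ℕ) (x : X) :
    birkhoffSum T (fun x => f x + c) n x = birkhoffSum T f n x + n * c := by
  simp [birkhoffSum, Finset.sum_add_distrib]

lemma integral_nonneg_of_exists_nonneg {X : Type*} [MeasurableSpace X] {μ : Measure X}
    [IsProbabilityMeasure μ]
    {T : X → X} (hT : MeasurePreserving T μ μ) {f : X → ℝ} (hf : Measurable f) {C : ℝ}
    (hC : ∀ x, |f x| ≤ C) (h : ∀ᵐ x ∂μ, ∃ n, 1 ≤ n ∧ 0 ≤ birkhoffSum T f n x) :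
    0 ≤ ∫ x, f x ∂μ := by
  refine le_of_forall_pos_le_add fun ε hε => ?_
  have hfi : Integrable f μ := Integrable.of_bound hf.aestronglyMeasurable C (ae_of_all _ hC)
  have := integral_nonneg_of_exists_pos hT (f := fun x => f x + ε) (hf.add_const ε)
    (C := C + ε) (fun x => (abs_add_le _ _).trans (by rw [abs_of_pos hε]; linarith [hC x])) (by
      filter_upwards [h] with x ⟨n, hn1, hn⟩
      refine ⟨n, ?_⟩
      rw [birkhoffSum_add_const]
      have : (0:ℝ) < n := by exact_mod_cast hn1
      positivity)
  rw [integral_add hfi (integrable_const ε)] at this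
  simpa using this

lemma ae_bddAbove_of_integral_neg {X : Type*} [MeasurableSpace X] {μ : Measure X}
    [IsProbabilityMeasure μ]
    {T : X → X} (hT : Ergodic T μ) {f : X → ℝ} (hf : Measurable f) {C : ℝ}
    (hC : ∀ x, |f x| ≤ C) (hneg : ∫ x, f x ∂μ < 0) :
    ∀ᵐ x ∂μ, ∃ K : ℕ, ∀ n, birkhoffSum T f n x ≤ K := by
  set E : Set X := {x | ∃ K : ℕ, ∀ n, birkhoffSum T f n x ≤ K} with hE
  have hm : MeasurableSet E := by
    have : E = ⋃ K : ℕ, ⋂ n, {x | birkhoffSum T f n x ≤ K} := by ext; simp [hE]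
    rw [this]
    exact MeasurableSet.iUnion fun K => MeasurableSet.iInter fun n =>
      measurableSet_le (measurable_birkhoffSum' hT.measurable hf n) measurable_const
  have hinv : T ⁻¹' E = E := by
    ext x
    constructor
    · rintro ⟨K, hK⟩
      obtain ⟨L, hL⟩ := exists_nat_ge (max 0 (f x + K))
      refine ⟨L, fun n => le_trans ?_ hL⟩
      cases n with
      | zero => simp
      | succ n => rw [birkhoffSum_succ']; exact le_max_of_le_right (by linarith [hK n])
    · rintro ⟨K, hK⟩
      obtain ⟨L, hL⟩ := exists_nat_ge (K - f x)
      refine ⟨L, fun n => ?_⟩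
      have := hK (n + 1)
      rw [birkhoffSum_succ'] at this
      linarith
  rcases hT.toPreErgodic.ae_mem_or_ae_notMem hm hinv with h | h
  · exact h
  · exfalso
    refine absurd (integral_nonneg_of_exists_pos hT.toMeasurePreserving hf hC ?_) (not_le.2 hneg)
    filter_upwards [h] with x hx
    by_contra hcon
    push Not at hcon
    exact hx ⟨0, fun n => by simpa using hcon n⟩

lemma ae_eventually_le {X : Type*} [MeasurableSpace X] {μ : Measure X}
    [IsProbabilityMeasure μ]
    {T : X → X} (hT : Ergodic T μ) {f : X → ℝ} (hf : Measurable f) {C : ℝ}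
    (hC : ∀ x, |f x| ≤ C) {ε : ℝ} (hε : 0 < ε) :
    ∀ᵐ x ∂μ, ∀ᶠ n : ℕ in atTop, birkhoffSum T f n x ≤ n * (∫ x, f x ∂μ + ε) := by
  set c := ∫ x, f x ∂μ with hc
  have hfi : Integrable f μ := Integrable.of_bound hf.aestronglyMeasurable C (ae_of_all _ hC)
  have := ae_bddAbove_of_integral_neg hT (f := fun x => f x + (-c - ε / 2)) (hf.add_const _)
    (C := C + |-c - ε / 2|) (fun x => (abs_add_le _ _).trans (by linarith [hC x])) (by
      rw [integral_add hfi (integrable_const _), ← hc]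
      simp; linarith)
  filter_upwards [this] with x ⟨K, hK⟩
  filter_upwards [eventually_ge_atTop ⌈(K / (ε / 2) : ℝ)⌉₊] with n hn
  have h1 := hK n
  rw [birkhoffSum_add_const] at h1
  have h2 := Nat.le_of_ceil_le hn
  rw [div_le_iff₀ (by positivity)] at h2
  nlinarith

/-- The pointwise ergodic theorem for bounded functions and ergodic measures. -/
lemma birkhoff_bounded {X : Type*} [MeasurableSpace X] {μ : Measure X}
    [IsProbabilityMeasure μ]
    {T : X → X} (hT : Ergodic T μ) {f : X → ℝ} (hf : Measurable f) {C : ℝ}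
    (hC : ∀ x, |f x| ≤ C) :
    ∀ᵐ x ∂μ, Tendsto (fun n : ℕ => birkhoffSum T f n x / n) atTop (𝓝 (∫ x, f x ∂μ)) := by
  have h1 : ∀ᵐ x ∂μ, ∀ k : ℕ, ∀ᶠ n : ℕ in atTop,
      birkhoffSum T f n x ≤ n * (∫ x, f x ∂μ + 1 / ((k : ℝ) + 1)) :=
    ae_all_iff.2 fun k => ae_eventually_le hT hf hC (by positivity)
  have h2 : ∀ᵐ x ∂μ, ∀ k : ℕ, ∀ᶠ n : ℕ in atTop,
      birkhoffSum T (-f) n x ≤ n * (∫ x, (-f) x ∂μ + 1 / ((k : ℝ) + 1)) :=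
    ae_all_iff.2 fun k => ae_eventually_le hT hf.neg (C := C) (by simpa using hC) (by positivity)
  filter_upwards [h1, h2] with x hx1 hx2
  rw [Metric.tendsto_nhds]
  intro ε hε
  obtain ⟨k, hk⟩ := exists_nat_one_div_lt hε
  filter_upwards [hx1 k, hx2 k, eventually_gt_atTop 0] with n hn1 hn2 hn0
  have hn : (0:ℝ) < n := by exact_mod_cast hn0
  rw [birkhoffSum_neg] at hn2
  simp only [Pi.neg_apply, integral_neg] at hn2
  rw [Real.dist_eq, abs_lt]
  constructor
  · rw [lt_sub_iff_add_lt, lt_div_iff₀ hn]; nlinarith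
  · rw [sub_lt_iff_lt_add, div_lt_iff₀ hn]; nlinarith
section Comb
variable {M N : ℕ}

lemma Hfun_zero (x : ℤ → DMSym M N) : Hfun x 0 = 0 := by simp [Hfun]

lemma Hfun_succ (x : ℤ → DMSym M N) (i : ℤ) : Hfun x (i + 1) = Hfun x i + Gfun x i := by
  rcases lt_or_ge i 0 with hi | hi
  · obtain ⟨n, rfl⟩ : ∃ n : ℕ, i = -((n : ℤ) + 1) := ⟨(-i - 1).toNat, by omega⟩
    have h1 : Hfun x (-((n : ℤ) + 1)) = -∑ j ∈ Finset.range (n + 1),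
        Gfun x (-((n : ℤ) + 1) + (j : ℤ)) := by
      unfold Hfun
      rw [if_neg (by omega)]
      congr 2
    have h2 : Hfun x (-((n : ℤ) + 1) + 1) = -∑ j ∈ Finset.range n,
        Gfun x (-(n : ℤ) + (j : ℤ)) := by
      rw [show -((n : ℤ) + 1) + 1 = -(n : ℤ) by ring]
      rcases Nat.eq_zero_or_pos n with rfl | hn
      · simp [Hfun]
      · unfold Hfun
        rw [if_neg (by omega), show (-(-(n : ℤ))).toNat = n by omega]
    rw [h1, h2, Finset.sum_range_succ']
    have : ∀ j : ℕ, -((n : ℤ) + 1) + ((j + 1 : ℕ) : ℤ) = -(n : ℤ) + j := fun j => by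
      push_cast; ring
    simp only [this]
    simp
  · obtain ⟨n, rfl⟩ := Int.eq_ofNat_of_zero_le hi
    have h1 : ∀ n : ℕ, Hfun x (n : ℤ) = ∑ j ∈ Finset.range n, Gfun x (j : ℤ) := fun n => by
      unfold Hfun
      rw [if_pos (by omega)]
      simp
    have h2 := h1 (n + 1)
    push_cast at h2
    rw [h2, h1, Finset.sum_range_succ]

lemma Gfun_la {x : ℤ → DMSym M N} {i : ℤ} {k : Fin M} (h : x i = .la k) : Gfun x i = 1 := by
  simp [Gfun, h]
lemma Gfun_ra {x : ℤ → DMSym M N} {i : ℤ} {k : Fin M} (h : x i = .ra k) : Gfun x i = -1 := by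
  simp [Gfun, h]
lemma Gfun_u {x : ℤ → DMSym M N} {i : ℤ} {k : Fin N} (h : x i = .u k) : Gfun x i = 0 := by
  simp [Gfun, h]

/-- `h` is a height function of `x`. -/
def IsHt (x : ℤ → DMSym M N) (h : ℤ → ℤ) : Prop := ∀ i, h (i + 1) = h i + Gfun x i

lemma isHt_Hfun (x : ℤ → DMSym M N) : IsHt x (Hfun x) := Hfun_succ x

lemma IsHt.eq {x : ℤ → DMSym M N} {h h' : ℤ → ℤ} (hh : IsHt x h) (hh' : IsHt x h') (i : ℤ) :
    h i - h' i = h 0 - h' 0 := by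
  induction i using Int.induction_on with
  | zero => rfl
  | succ i ih => rw [hh, hh']; linarith
  | pred i ih =>
    have h1 := hh (-(i : ℤ) - 1)
    have h2 := hh' (-(i : ℤ) - 1)
    rw [sub_add_cancel] at h1 h2
    linarith

/-- Matching brackets (with respect to heights) have the same index. -/
def Mat (x : ℤ → DMSym M N) (h : ℤ → ℤ) : Prop :=
  ∀ (i j : ℤ) (k l : Fin M), i < j → x i = .la k → x j = .ra l → h (j + 1) = h i →
    (∀ t, i < t → t ≤ j → h i < h t) → k = l

lemma Mat.congr {x : ℤ → DMSym M N} {h h' : ℤ → ℤ} (hm : Mat x h) (hh : IsHt x h)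
    (hh' : IsHt x h') : Mat x h' := by
  intro i j k l hij hk hl he ht
  have := hh.eq hh'
  refine hm i j k l hij hk hl ?_ fun t h1 h2 => ?_
  · have a := this i; have b := this (j + 1); omega
  · have a := this i; have b := this t; have c := ht t h1 h2; omega

/-- State after reading `n` letters from position `j`. -/
def stAt (x : ℤ → DMSym M N) (j : ℤ) (n : ℕ) : DyckElem M :=
  red ((List.range n).map fun m => x (j + (m : ℤ)))

lemma stAt_zero (x : ℤ → DMSym M N) (j : ℤ) : stAt x j 0 = some ([], []) := by
  simp [stAt, red]

lemma stAt_succ (x : ℤ → DMSym M N) (j : ℤ) (n : ℕ) :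
    stAt x j (n + 1) = dyckStep (stAt x j n) (x (j + (n : ℤ))) := by
  simp [stAt, red, List.range_succ, List.foldl_append]

lemma mem_SigmaD_of_Mat {x : ℤ → DMSym M N} {h : ℤ → ℤ} (hh : IsHt x h) (hm : Mat x h) :
    x ∈ SigmaD M N := by
  have key : ∀ (j : ℤ) (n : ℕ), ∃ bs l, stAt x j n = some (bs, List.reverse l) ∧
      ∀ (t : ℕ) (k : Fin M), l[t]? = some k → ∃ i, i < j + n ∧ x i = .la k ∧
        h i = h (j + n) - (t + 1) ∧ ∀ s, i < s → s ≤ j + n → h i < h s := by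
    intro j n
    induction n with
    | zero => exact ⟨[], [], by simp [stAt_zero], by simp⟩
    | succ n ih =>
      obtain ⟨bs, l, hst, hl⟩ := ih
      rw [stAt_succ, hst]
      have hstep := hh (j + n)
      have hcast : j + ((n + 1 : ℕ) : ℤ) = j + n + 1 := by push_cast; ring
      rw [hcast]
      rcases hx : x (j + n) with k | k | k
      · rw [Gfun_la hx] at hstep
        refine ⟨bs, k :: l, by simp [dyckStep], ?_⟩
        intro t m ht
        cases t with
        | zero =>
          simp at ht
          subst ht
          refine ⟨j + n, by omega, hx, by push_cast; omega, fun s h1 h2 => ?_⟩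
          have : s = j + n + 1 := by omega
          subst this; omega
        | succ t =>
          simp at ht
          obtain ⟨i, hi1, hi2, hi3, hi4⟩ := hl t m ht
          refine ⟨i, by omega, hi2, by push_cast; omega, fun s h1 h2 => ?_⟩
          rcases eq_or_ne s (j + n + 1) with rfl | hs
          · omega
          · exact hi4 s h1 (by omega)
      · rw [Gfun_u hx] at hstep
        refine ⟨bs, l, by simp [dyckStep], ?_⟩
        intro t m ht
        obtain ⟨i, hi1, hi2, hi3, hi4⟩ := hl t m ht
        refine ⟨i, by omega, hi2, by omega, fun s h1 h2 => ?_⟩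
        rcases eq_or_ne s (j + n + 1) with rfl | hs
        · omega
        · exact hi4 s h1 (by omega)
      · rw [Gfun_ra hx] at hstep
        cases l with
        | nil => exact ⟨bs ++ [k], [], by simp [dyckStep], by simp⟩
        | cons a l =>
          obtain ⟨i, hi1, hi2, hi3, hi4⟩ := hl 0 a (by simp)
          have hak : a = k := hm i (j + n) a k hi1 hi2 hx (by push_cast at hi3; omega) hi4
          refine ⟨bs, l, by simp [dyckStep, hak], ?_⟩
          intro t m ht
          obtain ⟨i, hi1, hi2, hi3, hi4⟩ := hl (t + 1) m (by simpa using ht)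
          push_cast at hi3
          refine ⟨i, by omega, hi2, by omega, fun s h1 h2 => ?_⟩
          rcases eq_or_ne s (j + n + 1) with rfl | hs
          · omega
          · exact hi4 s h1 (by omega)
  intro j k _ hred
  obtain ⟨bs, l, hst, -⟩ := key j (k + 1 - j).toNat
  rw [show stAt x j (k + 1 - j).toNat = red (wordAt x j k) from rfl, hred] at hst
  exact absurd hst (by simp)

lemma Mat_of_mem_SigmaD {x : ℤ → DMSym M N} {h : ℤ → ℤ} (hh : IsHt x h)
    (hx : x ∈ SigmaD M N) : Mat x h := by
  intro i j k l hij hk hl he ht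
  have hne : ∀ n : ℕ, 2 ≤ n → stAt x i n ≠ none := by
    intro n hn
    have := hx i (i + n - 1) (by omega)
    unfold wordAt at this
    rwa [show (i + n - 1 + 1 - i : ℤ).toNat = n by omega] at this
  have key : ∀ n : ℕ, i + 1 + n ≤ j → ∃ bs rest, stAt x i (n + 1) = some (bs, k :: rest) ∧
      (rest.length : ℤ) = h (i + 1 + n) - h i - 1 := by
    intro n
    induction n with
    | zero =>
      intro _
      refine ⟨[], [], ?_, ?_⟩
      · rw [stAt_succ, stAt_zero]; simp [dyckStep, hk]
      · have := hh i; rw [Gfun_la hk] at this; simp; omega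
    | succ n ih =>
      intro hn
      push_cast at hn
      obtain ⟨bs, rest, hst, hlen⟩ := ih (by omega)
      have hne' := hne (n + 1 + 1) (by omega)
      have hpos := ht (i + 1 + n + 1) (by omega) (by omega)
      have hstep := hh (i + 1 + n)
      rw [stAt_succ, hst] at hne' ⊢
      have hc1 : i + ((n + 1 : ℕ) : ℤ) = i + 1 + n := by push_cast; ring
      have hc2 : i + 1 + ((n + 1 : ℕ) : ℤ) = i + 1 + n + 1 := by push_cast; ring
      rw [hc1] at hne' ⊢
      rw [hc2]
      rcases hxs : x (i + 1 + n) with m | m | m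
      · rw [Gfun_la hxs] at hstep
        exact ⟨bs, rest ++ [m], by simp [dyckStep], by simp; omega⟩
      · rw [Gfun_u hxs] at hstep
        exact ⟨bs, rest, by simp [dyckStep], by omega⟩
      · rw [Gfun_ra hxs] at hstep
        rw [hxs] at hne'
        rcases List.eq_nil_or_concat rest with rfl | ⟨r, a, rfl⟩
        · simp at hlen; omega
        · have hlast : (k :: (r ++ [a])).getLast? = some a := by
            rw [← List.cons_append]; exact List.getLast?_concat ..
          have hdrop : (k :: (r ++ [a])).dropLast = k :: r := by
            rw [← List.cons_append, List.dropLast_concat]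
          simp only [List.concat_eq_append] at hne' hlen ⊢
          simp only [dyckStep, hlast, hdrop] at hne' ⊢
          by_cases ham : a = m
          · refine ⟨bs, r, by simp [ham], ?_⟩
            simp at hlen; omega
          · simp [ham] at hne'
  obtain ⟨bs, rest, hst, hlen⟩ := key (j - i - 1).toNat (by omega)
  rw [show (i + 1 + ((j - i - 1).toNat : ℤ)) = j by omega] at hlen
  have hstep := hh j
  rw [Gfun_ra hl] at hstep
  have hr : rest = [] := List.length_eq_zero_iff.1 (by omega)
  subst hr
  have hne' := hne ((j - i - 1).toNat + 1 + 1) (by omega)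
  rw [stAt_succ, hst, show i + (((j - i - 1).toNat + 1 : ℕ) : ℤ) = j by omega, hl] at hne'
  by_contra hkl
  simp [dyckStep, hkl] at hne'

end Comb
section Constr
variable {M N : ℕ}

/-- Closing data: position `i < 0` receives index `l` if the first passage of `h` to level `i`
is through a right bracket of index `l`. -/
def ClosedBy (x : ℤ → DMSym M N) (h : ℤ → ℤ) (i : ℤ) (l : Fin M) : Prop :=
  ∃ j, 0 ≤ j ∧ x j = .ra l ∧ h (j + 1) = i ∧ ∀ s, 0 ≤ s → s ≤ j → i < h s

lemma ClosedBy.unique {x : ℤ → DMSym M N} {h : ℤ → ℤ} {i : ℤ} {l l' : Fin M}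
    (h1 : ClosedBy x h i l) (h2 : ClosedBy x h i l') : l = l' := by
  obtain ⟨j, hj0, hj, hji, hjs⟩ := h1
  obtain ⟨j', hj0', hj', hji', hjs'⟩ := h2
  have : j = j' := by
    rcases lt_trichotomy j j' with hlt | heq | hlt
    · have := hjs' (j + 1) (by omega) (by omega); omega
    · exact heq
    · have := hjs (j' + 1) (by omega) (by omega); omega
  subst this
  rw [hj] at hj'
  exact DMSym.ra.inj hj'

open Classical in
/-- Index of the left bracket to be put at position `i < 0`. -/
noncomputable def closeIdx (k0 : Fin M) (x : ℤ → DMSym M N) (h : ℤ → ℤ) (i : ℤ) : Fin M :=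
  if H : ∃ l, ClosedBy x h i l then H.choose else k0

lemma closeIdx_eq {k0 : Fin M} {x : ℤ → DMSym M N} {h : ℤ → ℤ} {i : ℤ} {l : Fin M}
    (H : ClosedBy x h i l) : closeIdx k0 x h i = l := by
  have hex : ∃ l, ClosedBy x h i l := ⟨l, H⟩
  unfold closeIdx
  rw [dif_pos hex]
  exact hex.choose_spec.unique H

/-- The periodic point. -/
noncomputable def perPt (k0 : Fin M) (x : ℤ → DMSym M N) (n R : ℕ) : ℤ → DMSym M N := fun i =>
  if i % ((n : ℤ) + R) < n then x (i % ((n : ℤ) + R))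
  else .la (closeIdx k0 x (Hfun x) (i % ((n : ℤ) + R) - ((n : ℤ) + R)))

lemma periodic_add_mul {x : ℤ → DMSym M N} {P : ℤ} (hP : ∀ i, x (i + P) = x i) (q i : ℤ) :
    x (i + q * P) = x i := by
  induction q using Int.induction_on generalizing i with
  | zero => simp
  | succ q ih => rw [add_mul, one_mul, ← add_assoc, hP, ih]
  | pred q ih =>
    have := hP (i + (-(q : ℤ) - 1) * P)
    rw [← this, ← ih i]
    congr 1; ring

lemma Hfun_periodic {x : ℤ → DMSym M N} {P : ℤ} (hP : ∀ i, x (i + P) = x i) (i : ℤ) :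
    Hfun x (i + P) = Hfun x i + Hfun x P := by
  have h1 : IsHt x (fun i => Hfun x (i + P)) := by
    intro i
    have := Hfun_succ x (i + P)
    have h2 : Gfun x (i + P) = Gfun x i := by unfold Gfun; rw [hP]
    rw [h2] at this
    simp only
    rw [← this]
    congr 1; ring
  have := h1.eq (isHt_Hfun x) i
  simp [Hfun_zero] at this
  linarith

lemma Hfun_periodic_mul {x : ℤ → DMSym M N} {P : ℤ} (hP : ∀ i, x (i + P) = x i) (q i : ℤ) :
    Hfun x (i + q * P) = Hfun x i + q * Hfun x P := by
  induction q using Int.induction_on generalizing i with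
  | zero => simp
  | succ q ih => rw [add_mul, one_mul, ← add_assoc, Hfun_periodic hP, ih]; ring
  | pred q ih =>
    have := Hfun_periodic hP (i + (-(q : ℤ) - 1) * P)
    have h2 := ih i
    rw [show i + (-(q : ℤ) - 1) * P + P = i + (-(q : ℤ)) * P by ring, h2] at this
    linarith

lemma exists_alpha (hM : 2 ≤ M) {x : ℤ → DMSym M N} (hx : x ∈ SigmaD M N) (n R : ℕ)
    (hR : ∀ i : ℤ, 0 ≤ i → i ≤ n → -(R : ℤ) < Hfun x i) :
    ∃ y ∈ SigmaD M N, (∀ i, y (i + ((n : ℤ) + R)) = y i) ∧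
      (∀ i : ℤ, 0 ≤ i → i < n → y i = x i) ∧ 0 < Hfun y ((n : ℤ) + R) := by
  have hR0 : 0 < R := by
    have := hR 0 le_rfl (by omega); rw [Hfun_zero] at this; omega
  let k0 : Fin M := ⟨0, by omega⟩
  set P : ℤ := (n : ℤ) + R with hPdef
  have hPpos : 0 < P := by omega
  set y := perPt k0 x n R with hy
  have hyP : ∀ i, y (i + P) = y i := by
    intro i
    simp only [hy, perPt, ← hPdef, Int.add_emod_right]
  have hyx : ∀ i : ℤ, 0 ≤ i → i < n → y i = x i := by
    intro i h0 h1
    simp only [hy, perPt, ← hPdef]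
    rw [Int.emod_eq_of_lt h0 (by omega), if_pos h1]
  have hyneg : ∀ i : ℤ, -(R : ℤ) ≤ i → i < 0 → y i = .la (closeIdx k0 x (Hfun x) i) := by
    intro i h0 h1
    rw [← hyP i]
    simp only [hy, perPt, ← hPdef]
    rw [Int.emod_eq_of_lt (by omega) (by omega), if_neg (by omega)]
    congr 2; ring
  set h := Hfun y with hh
  have hpos : ∀ m : ℕ, (m : ℤ) ≤ n → h m = Hfun x m := by
    intro m
    induction m with
    | zero => intro _; simp [hh, Hfun_zero]
    | succ m ih =>
      intro hm
      push_cast at hm ⊢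
      rw [hh, Hfun_succ, Hfun_succ, ← hh, ih (by omega)]
      congr 1
      unfold Gfun
      rw [hyx m (by omega) (by omega)]
  have hneg : ∀ m : ℕ, m ≤ R → h (-(m : ℤ)) = -(m : ℤ) := by
    intro m
    induction m with
    | zero => intro _; simp [hh, Hfun_zero]
    | succ m ih =>
      intro hm
      have h1 := Hfun_succ y (-((m + 1 : ℕ) : ℤ))
      rw [Gfun_la (hyneg _ (by omega) (by omega)), ← hh] at h1
      rw [show -((m + 1 : ℕ) : ℤ) + 1 = -(m : ℤ) by push_cast; ring, ih (by omega)] at h1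
      push_cast at h1 ⊢
      omega
  have hneg' : ∀ i : ℤ, -(R : ℤ) ≤ i → i ≤ 0 → h i = i := by
    intro i h0 h1
    obtain ⟨m, rfl⟩ : ∃ m : ℕ, i = -(m : ℤ) := ⟨(-i).toNat, by omega⟩
    exact hneg m (by omega)
  have hpos' : ∀ i : ℤ, 0 ≤ i → i ≤ n → h i = Hfun x i := by
    intro i h0 h1
    obtain ⟨m, rfl⟩ := Int.eq_ofNat_of_zero_le h0
    exact hpos m h1
  have hmul : ∀ q i : ℤ, h (i + q * P) = h i + q * h P := Hfun_periodic_mul hyP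
  have hn : h n = -(R : ℤ) + h P := by
    have := hmul 1 (-(R : ℤ))
    rw [hneg R le_rfl] at this
    rw [show -(R : ℤ) + 1 * P = n by rw [hPdef]; ring] at this
    linarith
  have hd : 0 < h P := by
    have h1 := hR n (by omega) le_rfl
    rw [← hpos' n (by omega) le_rfl] at h1
    linarith
  have hge0 : ∀ i : ℤ, -(R : ℤ) ≤ i → i ≤ n → -(R : ℤ) ≤ h i := by
    intro i h0 h1
    rcases le_total i 0 with hi | hi
    · rw [hneg' i h0 hi]; exact h0
    · rw [hpos' i hi h1]; exact (hR i hi h1).le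
  have hge : ∀ i : ℤ, (n : ℤ) ≤ i → h n ≤ h i := by
    intro i hi
    have e := Int.emod_add_mul_ediv (i + R) P
    have m0 := Int.emod_nonneg (i + R) hPpos.ne'
    have m1 := Int.emod_lt_of_pos (i + R) hPpos
    have hq : 1 ≤ (i + R) / P := by
      rw [Int.le_ediv_iff_mul_le hPpos]; omega
    set q := (i + R) / P
    set m := (i + R) % P
    have h1 := hmul q (-(R : ℤ) + m)
    rw [show -(R : ℤ) + m + q * P = i by linarith] at h1
    have h2 := hge0 (-(R : ℤ) + m) (by omega) (by omega)
    rw [h1, hn]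
    nlinarith
  refine ⟨y, ?_, hyP, hyx, hd⟩
  have hxM : Mat x (Hfun x) := Mat_of_mem_SigmaD (isHt_Hfun x) hx
  refine mem_SigmaD_of_Mat (isHt_Hfun y) ?_
  rw [← hh]
  -- reduction to a pair starting in the main block
  have base : ∀ (i j : ℤ) (k l : Fin M), -(R : ℤ) ≤ i → i < n → i < j → y i = .la k →
      y j = .ra l → h (j + 1) = h i → (∀ t, i < t → t ≤ j → h i < h t) → k = l := by
    intro i j k l hi0 hi1 hij hk hl he ht
    have hjn : j < n := by
      by_contra hcon
      have h1 := ht n hi1 (by omega)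
      have h2 := hge (j + 1) (by omega)
      omega
    have hj0 : 0 ≤ j := by
      by_contra hcon
      rw [hyneg j (by omega) (by omega)] at hl
      exact absurd hl (by simp)
    rw [hyx j hj0 hjn] at hl
    rw [hpos' (j + 1) (by omega) (by omega)] at he
    rcases lt_or_ge i 0 with hi | hi
    · rw [hneg' i hi0 hi.le] at he ht
      rw [hyneg i hi0 hi] at hk
      rw [← DMSym.la.inj hk]
      refine closeIdx_eq ⟨j, hj0, hl, he, fun s h0 h1 => ?_⟩
      rw [← hpos' s h0 (by omega)]
      exact ht s (by omega) h1
    · rw [hyx i hi hi1] at hk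
      rw [hpos' i hi hi1.le] at he ht
      refine hxM i j k l hij hk hl he fun t h0 h1 => ?_
      rw [← hpos' t (by omega) (by omega)]
      exact ht t h0 h1
  intro i j k l hij hk hl he ht
  have e := Int.emod_add_mul_ediv (i + R) P
  have m0 := Int.emod_nonneg (i + R) hPpos.ne'
  have m1 := Int.emod_lt_of_pos (i + R) hPpos
  set q := (i + R) / P
  set m := (i + R) % P
  have hi' : i = (-(R : ℤ) + m) + q * P := by linarith
  have hj' : j = (j - q * P) + q * P := by ring
  have hyq := periodic_add_mul hyP q
  refine base (-(R : ℤ) + m) (j - q * P) k l (by omega) (by omega) (by linarith) ?_ ?_ ?_ ?_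
  · rw [← hyq, ← hi']; exact hk
  · rw [← hyq, ← hj']; exact hl
  · have h1 := hmul q (-(R : ℤ) + m)
    have h2 := hmul q (j - q * P + 1)
    rw [← hi'] at h1
    rw [show j - q * P + 1 + q * P = j + 1 by ring] at h2
    linarith
  · intro t h0 h1
    have h2 := hmul q (-(R : ℤ) + m)
    have h3 := hmul q t
    rw [← hi'] at h2
    have := ht (t + q * P) (by linarith) (by linarith)
    linarith

/-- Exchange left and right brackets. -/
def flipSym : DMSym M N → DMSym M N
  | .la k => .ra k
  | .u k => .u k
  | .ra k => .la k

lemma flipSym_flipSym (a : DMSym M N) : flipSym (flipSym a) = a := by cases a <;> rfl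

lemma flip_eq_la {a : DMSym M N} {k : Fin M} (h : flipSym a = .la k) : a = .ra k := by
  rw [← flipSym_flipSym a, h]; rfl
lemma flip_eq_ra {a : DMSym M N} {k : Fin M} (h : flipSym a = .ra k) : a = .la k := by
  rw [← flipSym_flipSym a, h]; rfl

/-- Time reversal about the block `[0,n)`. -/
def revAt (n : ℤ) (x : ℤ → DMSym M N) : ℤ → DMSym M N := fun i => flipSym (x (n - 1 - i))

lemma Gfun_revAt (n : ℤ) (x : ℤ → DMSym M N) (i : ℤ) :
    Gfun (revAt n x) i = -Gfun x (n - 1 - i) := by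
  unfold Gfun revAt
  cases x (n - 1 - i) <;> rfl

lemma isHt_revAt (n : ℤ) {x : ℤ → DMSym M N} {h : ℤ → ℤ} (hh : IsHt x h) :
    IsHt (revAt n x) (fun i => h (n - i)) := by
  intro i
  have := hh (n - 1 - i)
  rw [show n - 1 - i + 1 = n - i by ring] at this
  rw [Gfun_revAt]
  simp only
  rw [show n - (i + 1) = n - 1 - i by ring]
  linarith

lemma Hfun_revAt (n : ℤ) (x : ℤ → DMSym M N) (i : ℤ) :
    Hfun (revAt n x) i = Hfun x (n - i) - Hfun x n := by
  have := (isHt_revAt n (isHt_Hfun x)).eq (isHt_Hfun (revAt n x)) i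
  simp [Hfun_zero] at this
  linarith

lemma revAt_mem (n : ℤ) {x : ℤ → DMSym M N} (hx : x ∈ SigmaD M N) :
    revAt n x ∈ SigmaD M N := by
  have hm := Mat_of_mem_SigmaD (isHt_Hfun x) hx
  refine mem_SigmaD_of_Mat (isHt_revAt n (isHt_Hfun x)) ?_
  intro i j k l hij hk hl he ht
  simp only at he ht
  refine (hm (n - 1 - j) (n - 1 - i) l k (by omega) (flip_eq_ra hl) (flip_eq_la hk) ?_ ?_).symm
  · rw [show n - 1 - i + 1 = n - i by ring, show n - 1 - j = n - (j + 1) by ring]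
    exact he.symm
  · intro t h0 h1
    have := ht (n - t) (by omega) (by omega)
    rw [show n - 1 - j = n - (j + 1) by ring, he]
    simpa using this

lemma exists_beta (hM : 2 ≤ M) {x : ℤ → DMSym M N} (hx : x ∈ SigmaD M N) (n R : ℕ)
    (hR : ∀ i : ℤ, 0 ≤ i → i ≤ n → Hfun x n - Hfun x i < R) :
    ∃ y ∈ SigmaD M N, (∀ i, y (i + ((n : ℤ) + R)) = y i) ∧
      (∀ i : ℤ, 0 ≤ i → i < n → y i = x i) ∧ Hfun y ((n : ℤ) + R) < 0 := by
  obtain ⟨y, hy, hyP, hyx, hyH⟩ := exists_alpha hM (revAt_mem n hx) n R (by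
    intro i h0 h1
    rw [Hfun_revAt]
    have := hR (n - i) (by omega) (by omega)
    omega)
  refine ⟨revAt n y, revAt_mem n hy, ?_, ?_, ?_⟩
  · intro i
    unfold revAt
    rw [← hyP (n - 1 - (i + (n + R)))]
    congr 2; ring
  · intro i h0 h1
    unfold revAt
    rw [hyx _ (by omega) (by omega)]
    unfold revAt
    rw [flipSym_flipSym]
    congr 1; ring
  · rw [Hfun_revAt]
    have := Hfun_periodic hyP (n - (n + R))
    rw [show (n : ℤ) - (n + R) + (n + R) = n by ring] at this
    linarith

lemma abs_Hfun_le (x : ℤ → DMSym M N) (m : ℕ) : |Hfun x m| ≤ m := by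
  induction m with
  | zero => simp [Hfun_zero]
  | succ m ih =>
    push_cast
    rw [Hfun_succ]
    have : |Gfun x m| ≤ 1 := by unfold Gfun; cases x m <;> simp
    exact (abs_add_le _ _).trans (by linarith)

lemma periodic_Hfun_bound {y : ℤ → DMSym M N} {P : ℤ} (hP0 : 0 < P)
    (hP : ∀ i, y (i + P) = y i) (i : ℤ) : |Hfun y i - i / P * Hfun y P| ≤ P := by
  have e := Int.emod_add_mul_ediv i P
  have m0 := Int.emod_nonneg i hP0.ne'
  have m1 := Int.emod_lt_of_pos i hP0
  have h1 := Hfun_periodic_mul hP (i / P) (i % P)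
  rw [show i % P + i / P * P = i by linarith] at h1
  obtain ⟨m, hm⟩ := Int.eq_ofNat_of_zero_le m0
  have h2 := abs_Hfun_le y m
  rw [← hm] at h2
  rw [h1, add_sub_cancel_right]
  linarith

lemma mem_Aalpha_of_periodic {y : ℤ → DMSym M N} (hy : y ∈ SigmaD M N) {P : ℤ} (hP0 : 0 < P)
    (hP : ∀ i, y (i + P) = y i) (hH : 0 < Hfun y P) : y ∈ AalphaSet M N := by
  refine ⟨hy, ?_, ?_⟩
  · rw [tendsto_atTop]
    intro b
    filter_upwards [eventually_ge_atTop ((|b| + P) * P)] with i hi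
    have h1 : |b| + P ≤ i / P := by rwa [Int.le_ediv_iff_mul_le hP0]
    have h2 := abs_le.1 (periodic_Hfun_bound hP0 hP i)
    have h3 := le_abs_self b
    have h4 := abs_nonneg b
    nlinarith
  · rw [tendsto_atBot]
    intro b
    filter_upwards [eventually_le_atBot (-(|b| + P) * P)] with i hi
    have h1 : i / P ≤ -(|b| + P) := by
      have := Int.ediv_le_ediv hP0 hi
      rwa [Int.mul_ediv_cancel _ hP0.ne'] at this
    have h2 := abs_le.1 (periodic_Hfun_bound hP0 hP i)
    have h3 := neg_abs_le b
    have h4 := abs_nonneg b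
    nlinarith

lemma mem_Abeta_of_periodic {y : ℤ → DMSym M N} (hy : y ∈ SigmaD M N) {P : ℤ} (hP0 : 0 < P)
    (hP : ∀ i, y (i + P) = y i) (hH : Hfun y P < 0) : y ∈ AbetaSet M N := by
  refine ⟨hy, ?_, ?_⟩
  · rw [tendsto_atBot]
    intro b
    filter_upwards [eventually_ge_atTop ((|b| + P) * P)] with i hi
    have h1 : |b| + P ≤ i / P := by rwa [Int.le_ediv_iff_mul_le hP0]
    have h2 := abs_le.1 (periodic_Hfun_bound hP0 hP i)
    have h3 := neg_abs_le b
    have h4 := abs_nonneg b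
    nlinarith
  · rw [tendsto_atTop]
    intro b
    filter_upwards [eventually_le_atBot (-(|b| + P) * P)] with i hi
    have h1 : i / P ≤ -(|b| + P) := by
      have := Int.ediv_le_ediv hP0 hi
      rwa [Int.mul_ediv_cancel _ hP0.ne'] at this
    have h2 := abs_le.1 (periodic_Hfun_bound hP0 hP i)
    have h3 := le_abs_self b
    have h4 := abs_nonneg b
    nlinarith

lemma Hfun_shift (x : ℤ → DMSym M N) (i : ℤ) : Hfun (shift x) i = Hfun x (i + 1) - Hfun x 1 := by
  have h1 : IsHt (shift x) (fun i => Hfun x (i + 1)) := fun i => Hfun_succ x (i + 1)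
  have := h1.eq (isHt_Hfun (shift x)) i
  simp [Hfun_zero] at this
  linarith

end Constr
section Orb
variable {X : Type*} [MeasurableSpace X]

/-- Uniform measure on a periodic orbit. -/
noncomputable def orbMeas (T : X → X) (y : X) (P : ℕ) : Measure X :=
  (P : ℝ≥0∞)⁻¹ • ∑ i ∈ Finset.range P, Measure.dirac (T^[i] y)

lemma orbMeas_eq_one {T : X → X} {y : X} {P : ℕ} (hP : 0 < P) {S : Set X}
    (hS : ∀ i, T^[i] y ∈ S) : orbMeas T y P S = 1 := by
  unfold orbMeas
  rw [Measure.smul_apply, Measure.finsetSum_apply]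
  rw [Finset.sum_congr rfl fun i _ => Measure.dirac_apply_of_mem (hS i)]
  simp only [Finset.sum_const, Finset.card_range, smul_eq_mul, nsmul_eq_mul, mul_one]
  exact ENNReal.inv_mul_cancel (by exact_mod_cast hP.ne') (ENNReal.natCast_ne_top P)

lemma orbMeas_isProb {T : X → X} {y : X} {P : ℕ} (hP : 0 < P) :
    IsProbabilityMeasure (orbMeas T y P) := ⟨orbMeas_eq_one hP fun _ => trivial⟩

lemma orbMeas_preserving {T : X → X} (hT : Measurable T) {y : X} {P : ℕ}
    (hy : T^[P] y = y) : MeasurePreserving T (orbMeas T y P) (orbMeas T y P) := by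
  refine ⟨hT, ?_⟩
  ext s hs
  rw [Measure.map_apply hT hs]
  unfold orbMeas
  rw [Measure.smul_apply, Measure.smul_apply, Measure.finsetSum_apply, Measure.finsetSum_apply]
  congr 1
  have h1 : ∀ i, Measure.dirac (T^[i] y) (T ⁻¹' s) = Measure.dirac (T^[i + 1] y) s := by
    intro i
    rw [Measure.dirac_apply' _ (hT hs), Measure.dirac_apply' _ hs, Function.iterate_succ_apply']
    rfl
  simp only [h1]
  have h2 := Finset.sum_range_succ (fun i => Measure.dirac (T^[i] y) s) P
  rw [Finset.sum_range_succ'] at h2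
  simp only [hy, Function.iterate_zero, id] at h2
  refine (ENNReal.add_left_inj ?_).1 h2
  exact (prob_le_one.trans_lt ENNReal.one_lt_top).ne

lemma orbMeas_ergodic {T : X → X} (hT : Measurable T) {y : X} {P : ℕ} (hP : 0 < P)
    (hy : T^[P] y = y) : Ergodic T (orbMeas T y P) := by
  have := orbMeas_isProb (T := T) (y := y) hP
  refine { orbMeas_preserving hT hy with aeconst_set := ?_ }
  intro s hs hinv
  rw [eventuallyConst_set]
  have hit : ∀ i, T^[i] y ∈ s ↔ y ∈ s := by
    intro i
    induction i with
    | zero => rfl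
    | succ i ih =>
      rw [Function.iterate_succ_apply', ← ih]
      exact ⟨fun h => by rw [← hinv]; exact h, fun h => by rw [← hinv] at h; exact h⟩
  by_cases hys : y ∈ s
  · left
    exact (mem_ae_iff_prob_eq_one hs).2 (orbMeas_eq_one hP fun i => (hit i).2 hys)
  · right
    exact (mem_ae_iff_prob_eq_one hs.compl).2 (orbMeas_eq_one hP fun i h => hys ((hit i).1 h))

lemma integral_orbMeas (T : X → X) (y : X) (P : ℕ) {f : X → ℝ} (hf : StronglyMeasurable f) :
    ∫ x, f x ∂(orbMeas T y P) = birkhoffSum T f P y / P := by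
  unfold orbMeas
  rw [integral_smul_measure, integral_finsetSum_measure]
  · simp only [integral_dirac' f _ hf, birkhoffSum]
    simp [div_eq_inv_mul]
  · intro i _
    exact integrable_dirac' hf (by simp)

/-- Uniform measure on a periodic orbit as a probability measure. -/
noncomputable def orbPM (T : X → X) (y : X) (P : ℕ) (hP : 0 < P) : ProbabilityMeasure X :=
  ⟨orbMeas T y P, orbMeas_isProb hP⟩

end Orb

lemma exists_small_envelope {a : ℕ → ℝ} (ha : Tendsto (fun n : ℕ => a n / n) atTop (𝓝 0)) :
    ∃ R : ℕ → ℕ, Tendsto (fun n : ℕ => (R n : ℝ) / n) atTop (𝓝 0) ∧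
      ∀ n i, i ≤ n → 2 * |a i| < R n := by
  refine ⟨fun n => (Finset.range (n + 1)).sup (fun i => ⌈2 * |a i|⌉₊) + 1, ?_, ?_⟩
  · rw [Metric.tendsto_atTop] at ha ⊢
    intro ε hε
    obtain ⟨n0, hn0⟩ := ha (ε / 8) (by positivity)
    set K := (Finset.range (n0 + 1)).sup (fun i => ⌈2 * |a i|⌉₊) with hK
    obtain ⟨n1, hn1⟩ := exists_nat_gt ((K + 2) / (ε / 2))
    refine ⟨n1 + 1, fun n hn => ?_⟩
    have hnpos : (0:ℝ) < n := by exact_mod_cast (by omega : 0 < n)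
    have hsup : (Finset.range (n + 1)).sup (fun i => ⌈2 * |a i|⌉₊) ≤ K + ⌈2 * (ε / 8 * n)⌉₊ := by
      refine Finset.sup_le fun i hi => ?_
      rw [Finset.mem_range] at hi
      rcases lt_or_ge i (n0 + 1) with h | h
      · have := Finset.le_sup (f := fun i => ⌈2 * |a i|⌉₊) (Finset.mem_range.2 h)
        simp only [← hK] at this
        omega
      · refine le_add_left (Nat.ceil_le_ceil ?_)
        have hipos : 0 < i := by omega
        have h1 := hn0 i (by omega)
        have hi0 : (0:ℝ) < i := by exact_mod_cast hipos
        rw [Real.dist_eq, sub_zero, abs_div, abs_of_pos hi0, div_lt_iff₀ hi0] at h1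
        have h2 : (i:ℝ) ≤ n := by exact_mod_cast (by omega : i ≤ n)
        nlinarith
    have hceil := Nat.ceil_lt_add_one (show (0:ℝ) ≤ 2 * (ε / 8 * n) by positivity)
    have hcast : (((Finset.range (n + 1)).sup (fun i => ⌈2 * |a i|⌉₊) : ℕ) : ℝ)
        ≤ K + ⌈2 * (ε / 8 * n)⌉₊ := by exact_mod_cast hsup
    rw [Real.dist_eq, sub_zero, abs_of_nonneg (by positivity), div_lt_iff₀ hnpos]
    rw [div_lt_iff₀ (by positivity)] at hn1
    have h3 : (n1:ℝ) ≤ n := by exact_mod_cast (by omega : n1 ≤ n)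
    push_cast
    nlinarith
  · intro n i hi
    have h1 := Finset.le_sup (f := fun i => ⌈2 * |a i|⌉₊) (Finset.mem_range.2 (Nat.lt_succ_of_le hi))
    have h2 := Nat.le_ceil (2 * |a i|)
    have h3 : ((⌈2 * |a i|⌉₊ : ℕ) : ℝ) ≤
      (((Finset.range (n + 1)).sup (fun i => ⌈2 * |a i|⌉₊) : ℕ) : ℝ) := by exact_mod_cast h1
    push_cast
    linarith
section Final
variable {M N : ℕ}

lemma isClosed_SigmaD : IsClosed (SigmaD M N) := by
  rw [← isOpen_compl_iff, isOpen_iff_mem_nhds]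
  intro x hx
  have hx' : ∃ j k : ℤ, j < k ∧ red (wordAt x j k) = none := by
    by_contra hcon
    push Not at hcon
    exact hx fun j k hjk => hcon j k hjk
  obtain ⟨j, k, hjk, hred⟩ := hx'
  have hopen : IsOpen (Set.pi (Set.Icc j k) fun i => ({x i} : Set (DMSym M N))) :=
    isOpen_set_pi (Set.finite_Icc j k) fun i _ => isOpen_discrete _
  refine mem_of_superset (hopen.mem_nhds fun i _ => rfl) fun z hz hzS => ?_
  refine hzS j k hjk ?_
  rw [← hred]
  change stAt z j (k + 1 - j).toNat = stAt x j (k + 1 - j).toNat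
  unfold stAt
  congr 1
  refine List.map_congr_left fun n hn => ?_
  obtain ⟨a, ha, rfl⟩ : ∃ a : ℕ, a < (k + 1 - j).toNat ∧ (a : ℤ) = n := by
    simpa [eq_comm] using hn
  exact hz (j + a) ⟨by omega, by omega⟩

instance : CompactSpace ↥(SigmaD M N) := isCompact_iff_compactSpace.1 isClosed_SigmaD.isCompact

lemma continuous_shiftD : Continuous (shiftD M N) := by
  refine Continuous.subtype_mk ?_ _
  exact continuous_pi fun i => (continuous_apply (i + 1)).comp continuous_subtype_val

lemma iterate_shiftD (x : ↥(SigmaD M N)) (n : ℕ) (i : ℤ) :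
    ((shiftD M N)^[n] x).1 i = x.1 (i + n) := by
  induction n generalizing i with
  | zero => simp
  | succ n ih =>
    rw [Function.iterate_succ_apply']
    change ((shiftD M N)^[n] x).1 (i + 1) = _
    rw [ih, show i + 1 + (n : ℤ) = i + ((n + 1 : ℕ) : ℤ) by push_cast; ring]

lemma unif_cont (f : C(↥(SigmaD M N), ℝ)) {ε : ℝ} (hε : 0 < ε) :
    ∃ L : ℕ, ∀ u v : ↥(SigmaD M N), (∀ i : ℤ, |i| ≤ L → u.1 i = v.1 i) → |f u - f v| < ε := by
  by_contra hcon
  push Not at hcon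
  choose u v huv hf using hcon
  obtain ⟨w, hw⟩ : ∃ w, (Ultrafilter.map u (Filter.hyperfilter ℕ) : Filter ↥(SigmaD M N)) ≤ 𝓝 w := by
    obtain ⟨w, -, hw⟩ := isCompact_univ.ultrafilter_le_nhds
      (Ultrafilter.map u (Filter.hyperfilter ℕ)) (by simp)
    exact ⟨w, hw⟩
  have hu : Tendsto u (Filter.hyperfilter ℕ : Filter ℕ) (𝓝 w) := hw
  have hv : Tendsto v (Filter.hyperfilter ℕ : Filter ℕ) (𝓝 w) := by
    rw [tendsto_subtype_rng, tendsto_pi_nhds]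
    intro i
    have h1 : Tendsto (fun n => (u n).1 i) (Filter.hyperfilter ℕ : Filter ℕ) (𝓝 (w.1 i)) :=
      tendsto_pi_nhds.1 (tendsto_subtype_rng.1 hu) i
    refine h1.congr' ?_
    have h2 : ∀ᶠ n : ℕ in (Filter.hyperfilter ℕ : Filter ℕ), i.natAbs ≤ n :=
      Nat.hyperfilter_le_atTop (eventually_ge_atTop i.natAbs)
    filter_upwards [h2] with n hn
    exact huv n i (by rw [Int.abs_eq_natAbs]; exact_mod_cast hn)
  have h1 := ((f.continuous.tendsto w).comp hu).sub ((f.continuous.tendsto w).comp hv)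
  rw [sub_self] at h1
  obtain ⟨n, hn⟩ := ((Metric.tendsto_nhds.1 h1) ε hε).exists
  rw [Real.dist_eq, sub_zero] at hn
  exact absurd (hf n) (not_le.2 hn)

lemma abs_birkhoffSum_sub_le (f : C(↥(SigmaD M N), ℝ)) {C ε : ℝ} (hC : ∀ x, |f x| ≤ C)
    (hε : 0 < ε) {L : ℕ}
    (hL : ∀ u v : ↥(SigmaD M N), (∀ i : ℤ, |i| ≤ L → u.1 i = v.1 i) → |f u - f v| < ε)
    (x y : ↥(SigmaD M N)) (n R : ℕ) (hxy : ∀ i : ℤ, 0 ≤ i → i < n → y.1 i = x.1 i) :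
    |birkhoffSum (shiftD M N) f (n + R) y - birkhoffSum (shiftD M N) f n x|
      ≤ ε * n + 4 * L * C + R * C := by
  have hC0 : 0 ≤ C := (abs_nonneg _).trans (hC x)
  have h1 : birkhoffSum (shiftD M N) f (n + R) y - birkhoffSum (shiftD M N) f n x
      = ∑ i ∈ Finset.range n, (f ((shiftD M N)^[i] y) - f ((shiftD M N)^[i] x))
        + ∑ i ∈ Finset.range R, f ((shiftD M N)^[n + i] y) := by
    unfold birkhoffSum
    rw [Finset.sum_range_add, Finset.sum_sub_distrib]
    ring
  have h2 : |∑ i ∈ Finset.range R, f ((shiftD M N)^[n + i] y)| ≤ R * C := by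
    refine (Finset.abs_sum_le_sum_abs _ _).trans ((Finset.sum_le_sum fun i _ => hC _).trans ?_)
    simp
  have h3 : |∑ i ∈ Finset.range n, (f ((shiftD M N)^[i] y) - f ((shiftD M N)^[i] x))|
      ≤ ε * n + 4 * L * C := by
    refine (Finset.abs_sum_le_sum_abs _ _).trans ?_
    have hterm : ∀ i ∈ Finset.range n, |f ((shiftD M N)^[i] y) - f ((shiftD M N)^[i] x)|
        ≤ ε + ((if i < L then 2 * C else 0) + (if n ≤ i + L then 2 * C else 0)) := by
      intro i hi
      rw [Finset.mem_range] at hi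
      have hb : |f ((shiftD M N)^[i] y) - f ((shiftD M N)^[i] x)| ≤ 2 * C :=
        (abs_sub _ _).trans (by linarith [hC ((shiftD M N)^[i] y), hC ((shiftD M N)^[i] x)])
      by_cases ha : i < L
      · rw [if_pos ha]
        split_ifs <;> linarith
      · by_cases hb' : n ≤ i + L
        · rw [if_pos hb']
          split_ifs; linarith
        · rw [if_neg ha, if_neg hb']
          have := hL ((shiftD M N)^[i] y) ((shiftD M N)^[i] x) (by
            intro t ht
            rw [iterate_shiftD, iterate_shiftD]
            rw [abs_le] at ht
            exact hxy _ (by omega) (by omega))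
          linarith
    refine (Finset.sum_le_sum hterm).trans ?_
    rw [Finset.sum_add_distrib, Finset.sum_add_distrib]
    have ha : ∑ i ∈ Finset.range n, (if i < L then 2 * C else 0) ≤ L * (2 * C) := by
      rw [← Finset.sum_filter, Finset.sum_const, nsmul_eq_mul]
      have : ((Finset.range n).filter (fun i => i < L)).card ≤ L := by
        refine (Finset.card_le_card (t := Finset.range L) fun i hi => ?_).trans (by simp)
        simp at hi ⊢
        omega
      have : (((Finset.range n).filter (fun i => i < L)).card : ℝ) ≤ L := by exact_mod_cast this
      nlinarith
    have hb : ∑ i ∈ Finset.range n, (if n ≤ i + L then 2 * C else 0) ≤ L * (2 * C) := by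
      rw [← Finset.sum_filter, Finset.sum_const, nsmul_eq_mul]
      have : ((Finset.range n).filter (fun i => n ≤ i + L)).card ≤ L := by
        refine (Finset.card_le_card (t := Finset.Ico (n - L) n) fun i hi => ?_).trans ?_
        · simp at hi ⊢
          omega
        · rw [Nat.card_Ico]
          omega
      have : (((Finset.range n).filter (fun i => n ≤ i + L)).card : ℝ) ≤ L := by
        exact_mod_cast this
      nlinarith
    simp only [Finset.sum_const, Finset.card_range, nsmul_eq_mul]
    linarith
  rw [h1]
  refine (abs_add_le _ _).trans ?_
  linarith

lemma exists_bound (f : C(↥(SigmaD M N), ℝ)) : ∃ C, ∀ x, |f x| ≤ C :=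
  ⟨‖f‖, fun x => f.norm_coe_le_norm x⟩

lemma tendsto_periodic (f : C(↥(SigmaD M N), ℝ)) {c : ℝ} (x : ↥(SigmaD M N))
    (y : ℕ → ↥(SigmaD M N)) (R : ℕ → ℕ)
    (hR : Tendsto (fun n : ℕ => (R n : ℝ) / n) atTop (𝓝 0))
    (hxy : ∀ (n : ℕ) (i : ℤ), 0 ≤ i → i < n → (y n).1 i = x.1 i)
    (hx : Tendsto (fun n : ℕ => birkhoffSum (shiftD M N) f n x / n) atTop (𝓝 c)) :
    Tendsto (fun n : ℕ => birkhoffSum (shiftD M N) f (n + R n) (y n) / ((n + R n : ℕ) : ℝ))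
      atTop (𝓝 c) := by
  obtain ⟨C, hC⟩ := exists_bound f
  have hC0 : 0 ≤ C := (abs_nonneg _).trans (hC x)
  have h1 : Tendsto (fun n : ℕ => (birkhoffSum (shiftD M N) f (n + R n) (y n)
      - birkhoffSum (shiftD M N) f n x) / n) atTop (𝓝 0) := by
    rw [Metric.tendsto_nhds]
    intro ε hε
    obtain ⟨L, hL⟩ := unif_cont f (half_pos hε)
    have hlim : Tendsto (fun n : ℕ => (4 * L * C) / (n : ℝ) + (R n : ℝ) / n * C) atTop (𝓝 0) := by
      have := (tendsto_const_div_atTop_nhds_zero_nat (4 * L * C)).add (hR.mul_const C)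
      simpa using this
    filter_upwards [hlim.eventually_lt_const (half_pos hε), eventually_gt_atTop 0] with n hn hn0
    have hnpos : (0:ℝ) < n := by exact_mod_cast hn0
    have := abs_birkhoffSum_sub_le f hC (half_pos hε) hL x (y n) n (R n) (hxy n)
    rw [Real.dist_eq, sub_zero, abs_div, abs_of_pos hnpos, div_lt_iff₀ hnpos]
    have e : ((4 * L * C) / (n : ℝ) + (R n : ℝ) / n * C) * n = 4 * L * C + R n * C := by
      field_simp
    have := mul_lt_mul_of_pos_right hn hnpos
    rw [e] at this
    linarith
  have h2 := h1.add hx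
  rw [zero_add] at h2
  have h3 : Tendsto (fun n : ℕ => (1 + (R n : ℝ) / n)⁻¹) atTop (𝓝 1) := by
    have := (hR.const_add 1).inv₀ (by simp)
    simpa using this
  have h4 := h2.mul h3
  rw [mul_one] at h4
  refine h4.congr' ?_
  filter_upwards [eventually_gt_atTop 0] with n hn0
  have hnpos : (0:ℝ) < n := by exact_mod_cast hn0
  have : (0:ℝ) ≤ R n := by positivity
  have : (n:ℝ) + R n ≠ 0 := by positivity
  push_cast
  field_simp
  ring

lemma ae_generic {μ : Measure ↥(SigmaD M N)} [IsProbabilityMeasure μ]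
    (hμ : Ergodic (shiftD M N) μ) :
    ∀ᵐ x ∂μ, ∀ f : C(↥(SigmaD M N), ℝ),
      Tendsto (fun n : ℕ => birkhoffSum (shiftD M N) f n x / n) atTop (𝓝 (∫ x, f x ∂μ)) := by
  obtain ⟨s, hsc, hsd⟩ := TopologicalSpace.exists_countable_dense C(↥(SigmaD M N), ℝ)
  have hMint : ∀ f : C(↥(SigmaD M N), ℝ), Integrable f μ := fun f =>
    Integrable.of_bound f.continuous.measurable.aestronglyMeasurable ‖f‖
      (ae_of_all _ fun x => f.norm_coe_le_norm x)
  have h1 : ∀ᵐ x ∂μ, ∀ f ∈ s,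
      Tendsto (fun n : ℕ => birkhoffSum (shiftD M N) f n x / n) atTop (𝓝 (∫ x, f x ∂μ)) := by
    rw [ae_ball_iff hsc]
    intro f _
    obtain ⟨C, hC⟩ := exists_bound f
    exact birkhoff_bounded hμ f.continuous.measurable hC
  filter_upwards [h1] with x hx f
  rw [Metric.tendsto_nhds]
  intro ε hε
  obtain ⟨g, hgs, hg⟩ := hsd.exists_dist_lt f (show 0 < ε / 3 by positivity)
  have hfg : ∀ z, |f z - g z| ≤ ε / 3 := fun z => by
    rw [← Real.dist_eq]; exact (ContinuousMap.dist_apply_le_dist z).trans hg.le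
  have hi : |∫ x, f x ∂μ - ∫ x, g x ∂μ| ≤ ε / 3 := by
    rw [← integral_sub (hMint f) (hMint g)]
    have := norm_integral_le_of_norm_le_const (μ := μ) (f := fun x => f x - g x) (C := ε / 3)
      (ae_of_all _ hfg)
    simpa using this
  filter_upwards [(Metric.tendsto_nhds.1 (hx g hgs)) (ε / 3) (by positivity),
    eventually_gt_atTop 0] with n hn hn0
  have hnpos : (0:ℝ) < n := by exact_mod_cast hn0
  have hs : |birkhoffSum (shiftD M N) f n x / n - birkhoffSum (shiftD M N) g n x / n| ≤ ε / 3 := by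
    rw [← sub_div, abs_div, abs_of_pos hnpos, div_le_iff₀ hnpos]
    unfold birkhoffSum
    rw [← Finset.sum_sub_distrib]
    refine (Finset.abs_sum_le_sum_abs _ _).trans ((Finset.sum_le_sum fun i _ => hfg _).trans ?_)
    simp [mul_comm]
  rw [Real.dist_eq] at hn ⊢
  rw [abs_lt] at hn ⊢
  rw [abs_le] at hs hi
  constructor <;> linarith

/-- The observable `G_0` as a real function on the shift. -/
def Gr (x : ↥(SigmaD M N)) : ℝ := (Gfun x.1 0 : ℤ)

lemma abs_Gr_le (x : ↥(SigmaD M N)) : |Gr x| ≤ 1 := by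
  unfold Gr Gfun
  cases x.1 0 <;> simp

lemma measurable_Gr : Measurable (Gr : ↥(SigmaD M N) → ℝ) := by
  have h : Measurable (fun a : DMSym M N => (((match a with
    | .la _ => 1
    | .u _ => 0
    | .ra _ => -1 : ℤ)) : ℝ)) := measurable_from_top
  exact h.comp ((measurable_pi_apply 0).comp measurable_subtype_coe)

lemma birkhoffSum_Gr (x : ↥(SigmaD M N)) (n : ℕ) :
    birkhoffSum (shiftD M N) Gr n x = (Hfun x.1 n : ℤ) := by
  induction n with
  | zero => simp [Hfun_zero]
  | succ n ih =>
    rw [birkhoffSum_succ, ih]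
    push_cast
    rw [Hfun_succ]
    push_cast
    congr 1
    unfold Gr Gfun
    rw [iterate_shiftD, zero_add]

lemma ae_of_measure_eq_one {X : Type*} [MeasurableSpace X] {μ : Measure X}
    [IsProbabilityMeasure μ] {S : Set X} (hS : μ S = 1) {p : X → Prop}
    (hp : MeasurableSet {x | p x}) (h : ∀ x ∈ S, p x) : ∀ᵐ x ∂μ, p x := by
  refine (mem_ae_iff_prob_eq_one hp).2 (le_antisymm prob_le_one ?_)
  rw [← hS]
  exact measure_mono h

lemma measurable_exists_nonneg {f : ↥(SigmaD M N) → ℝ} (hf : Measurable f) :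
    MeasurableSet {x | ∃ n, 1 ≤ n ∧ 0 ≤ birkhoffSum (shiftD M N) f n x} := by
  have : {x | ∃ n, 1 ≤ n ∧ 0 ≤ birkhoffSum (shiftD M N) f n x}
      = ⋃ n : ℕ, ⋃ _ : 1 ≤ n, {x | 0 ≤ birkhoffSum (shiftD M N) f n x} := by
    ext; simp
  rw [this]
  exact MeasurableSet.iUnion fun n => MeasurableSet.iUnion fun _ =>
    measurableSet_le measurable_const
      (measurable_birkhoffSum' continuous_shiftD.measurable hf n)

lemma integral_Gr_nonneg {μ : Measure ↥(SigmaD M N)} [IsProbabilityMeasure μ]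
    (hμ : MeasurePreserving (shiftD M N) μ μ) {S : Set ↥(SigmaD M N)} (hS : μ S = 1)
    (h : ∀ x ∈ S, ∃ n : ℕ, 1 ≤ n ∧ 0 ≤ Hfun x.1 n) : 0 ≤ ∫ x, Gr x ∂μ := by
  refine integral_nonneg_of_exists_nonneg hμ measurable_Gr abs_Gr_le
    (ae_of_measure_eq_one hS (measurable_exists_nonneg measurable_Gr) fun x hx => ?_)
  obtain ⟨n, h1, h2⟩ := h x hx
  refine ⟨n, h1, ?_⟩
  rw [birkhoffSum_Gr]
  exact_mod_cast h2

lemma integral_Gr_nonpos {μ : Measure ↥(SigmaD M N)} [IsProbabilityMeasure μ]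
    (hμ : MeasurePreserving (shiftD M N) μ μ) {S : Set ↥(SigmaD M N)} (hS : μ S = 1)
    (h : ∀ x ∈ S, ∃ n : ℕ, 1 ≤ n ∧ Hfun x.1 n ≤ 0) : ∫ x, Gr x ∂μ ≤ 0 := by
  have := integral_nonneg_of_exists_nonneg hμ (f := -Gr) measurable_Gr.neg (C := 1)
    (by simpa using abs_Gr_le)
    (ae_of_measure_eq_one hS (measurable_exists_nonneg measurable_Gr.neg) fun x hx => by
      obtain ⟨n, h1, h2⟩ := h x hx
      refine ⟨n, h1, ?_⟩
      rw [birkhoffSum_neg, birkhoffSum_Gr]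
      have : ((Hfun x.1 n : ℤ) : ℝ) ≤ 0 := by exact_mod_cast h2
      linarith)
  simp only [Pi.neg_apply, integral_neg] at this
  linarith

lemma mem_closure_of_construction {μ : ProbabilityMeasure ↥(SigmaD M N)}
    (hμ : μ ∈ MergD M N) (Q : Set (ℤ → DMSym M N))
    (hQ : ∀ y ∈ Q, shift y ∈ Q)
    (hcon : ∀ x ∈ SigmaD M N, ∀ n R : ℕ,
      (∀ i : ℕ, i ≤ n → 2 * |(Hfun x i : ℤ) - (∫ x, Gr x ∂μ.toMeasure) * i| < (R : ℝ)) →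
      ∃ y ∈ SigmaD M N, (∀ i, y (i + ((n : ℤ) + R)) = y i) ∧
        (∀ i : ℤ, 0 ≤ i → i < n → y i = x i) ∧ y ∈ Q) :
    μ ∈ closure ({ν ∈ MergD M N | ν.toMeasure (Subtype.val ⁻¹' Q) = 1} ∩ MCO M N) := by
  have herg : Ergodic (shiftD M N) μ.toMeasure := hμ
  obtain ⟨x, hx, hxG⟩ := ((ae_generic herg).and
    (birkhoff_bounded herg measurable_Gr abs_Gr_le)).exists
  set c := ∫ x, Gr x ∂μ.toMeasure with hc
  have ha : Tendsto (fun n : ℕ => ((Hfun x.1 n : ℤ) - c * n) / (n : ℝ)) atTop (𝓝 0) := by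
    have h1 := hxG.sub_const c
    rw [sub_self] at h1
    refine h1.congr' ?_
    filter_upwards [eventually_gt_atTop 0] with n hn0
    have hnpos : (n : ℝ) ≠ 0 := by exact_mod_cast hn0.ne'
    rw [birkhoffSum_Gr, sub_div, mul_div_cancel_right₀ _ hnpos]
  obtain ⟨R, hR0, hR⟩ := exists_small_envelope ha
  choose y hyS hyP hyx hyQ using fun n => hcon x.1 x.2 n (R n) (hR n)
  have hRpos : ∀ n, 0 < n + R n := by
    intro n
    have h1 := hR n 0 (by omega)
    have h2 : (0:ℝ) < R n := lt_of_le_of_lt (by positivity) h1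
    have h3 : 0 < R n := by exact_mod_cast h2
    omega
  let Y : ℕ → ↥(SigmaD M N) := fun n => ⟨y n, hyS n⟩
  have hper : ∀ n, (shiftD M N)^[n + R n] (Y n) = Y n := by
    intro n
    ext1
    funext i
    rw [iterate_shiftD]
    have := hyP n i
    push_cast
    exact this
  let ν : ℕ → ProbabilityMeasure ↥(SigmaD M N) := fun n =>
    orbPM (shiftD M N) (Y n) (n + R n) (hRpos n)
  have hνerg : ∀ n, Ergodic (shiftD M N) (ν n).toMeasure := fun n =>
    orbMeas_ergodic continuous_shiftD.measurable (hRpos n) (hper n)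
  have hlim : Tendsto ν atTop (𝓝 μ) := by
    rw [ProbabilityMeasure.tendsto_iff_forall_integral_tendsto]
    intro f
    have h1 := tendsto_periodic f.toContinuousMap x Y R hR0 hyx (hx f.toContinuousMap)
    refine h1.congr fun n => ?_
    exact (integral_orbMeas (shiftD M N) (Y n) (n + R n)
      f.continuous.measurable.stronglyMeasurable).symm
  refine mem_closure_of_tendsto hlim (Eventually.of_forall fun n => ⟨⟨hνerg n, ?_⟩, hνerg n, ?_⟩)
  · refine orbMeas_eq_one (hRpos n) fun i => ?_
    induction i with
    | zero => exact hyQ n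
    | succ i ih =>
      rw [Function.iterate_succ_apply']
      exact hQ _ ih
  · exact ⟨Y n, n + R n, hRpos n, hper n, orbMeas_eq_one (hRpos n) fun i => ⟨i, rfl⟩⟩

lemma shift_mem_Aalpha {y : ℤ → DMSym M N} (hy : y ∈ AalphaSet M N) :
    shift y ∈ AalphaSet M N := by
  obtain ⟨h1, h2, h3⟩ := hy
  have e : Hfun (shift y) = fun i => Hfun y (i + 1) + -Hfun y 1 := by
    funext i; rw [Hfun_shift]; ring
  refine ⟨shift_mem_SigmaD h1, ?_, ?_⟩
  · rw [e]
    exact tendsto_atTop_add_const_right _ _ (h2.comp (tendsto_atTop_add_const_right _ _ tendsto_id))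
  · rw [e]
    exact tendsto_atBot_add_const_right _ _ (h3.comp (tendsto_atBot_add_const_right _ _ tendsto_id))

lemma shift_mem_Abeta {y : ℤ → DMSym M N} (hy : y ∈ AbetaSet M N) :
    shift y ∈ AbetaSet M N := by
  obtain ⟨h1, h2, h3⟩ := hy
  have e : Hfun (shift y) = fun i => Hfun y (i + 1) + -Hfun y 1 := by
    funext i; rw [Hfun_shift]; ring
  refine ⟨shift_mem_SigmaD h1, ?_, ?_⟩
  · rw [e]
    exact tendsto_atBot_add_const_right _ _ (h2.comp (tendsto_atTop_add_const_right _ _ tendsto_id))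
  · rw [e]
    exact tendsto_atTop_add_const_right _ _ (h3.comp (tendsto_atBot_add_const_right _ _ tendsto_id))

lemma mem_closure_alpha (hM : 2 ≤ M) {μ : ProbabilityMeasure ↥(SigmaD M N)}
    (hμ : μ ∈ MergD M N) (hc : 0 ≤ ∫ x, Gr x ∂μ.toMeasure) :
    μ ∈ closure (MeAl M N ∩ MCO M N) := by
  refine mem_closure_of_construction hμ (AalphaSet M N) (fun _ => shift_mem_Aalpha) ?_
  intro x hx n R hR
  set c := ∫ x, Gr x ∂μ.toMeasure
  obtain ⟨y, hy, hyP, hyx, hH⟩ := exists_alpha hM hx n R (by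
    intro i h0 h1
    obtain ⟨m, rfl⟩ := Int.eq_ofNat_of_zero_le h0
    have h2 := hR m (by omega)
    have h3 := neg_abs_le (((Hfun x m : ℤ) : ℝ) - c * m)
    have h4 := abs_nonneg (((Hfun x m : ℤ) : ℝ) - c * m)
    have h5 : 0 ≤ c * m := by positivity
    have h6 : -(R : ℝ) < ((Hfun x m : ℤ) : ℝ) := by linarith
    exact_mod_cast h6)
  have hR0 : 0 < R := by
    have h2 : (0:ℝ) < R := lt_of_le_of_lt (by positivity) (hR 0 (by omega))
    exact_mod_cast h2
  exact ⟨y, hy, hyP, hyx, mem_Aalpha_of_periodic hy (by omega) hyP hH⟩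

lemma mem_closure_beta (hM : 2 ≤ M) {μ : ProbabilityMeasure ↥(SigmaD M N)}
    (hμ : μ ∈ MergD M N) (hc : ∫ x, Gr x ∂μ.toMeasure ≤ 0) :
    μ ∈ closure (MeBe M N ∩ MCO M N) := by
  refine mem_closure_of_construction hμ (AbetaSet M N) (fun _ => shift_mem_Abeta) ?_
  intro x hx n R hR
  set c := ∫ x, Gr x ∂μ.toMeasure
  obtain ⟨y, hy, hyP, hyx, hH⟩ := exists_beta hM hx n R (by
    intro i h0 h1
    obtain ⟨m, rfl⟩ := Int.eq_ofNat_of_zero_le h0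
    have h2 := hR m (by omega)
    have h2' := hR n le_rfl
    have h3 := neg_abs_le (((Hfun x m : ℤ) : ℝ) - c * m)
    have h3' := le_abs_self (((Hfun x n : ℤ) : ℝ) - c * n)
    have h4 : (m : ℝ) ≤ n := by exact_mod_cast h1
    have h5 : c * n ≤ c * m := mul_le_mul_of_nonpos_left h4 hc
    have h6 : ((Hfun x n : ℤ) : ℝ) - ((Hfun x m : ℤ) : ℝ) < R := by linarith
    exact_mod_cast h6)
  have hR0 : 0 < R := by
    have h2 : (0:ℝ) < R := lt_of_le_of_lt (by positivity) (hR 0 (by omega))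
    exact_mod_cast h2
  exact ⟨y, hy, hyP, hyx, mem_Abeta_of_periodic hy (by omega) hyP hH⟩

lemma Me0_return {x : ℤ → DMSym M N} (hx : x ∈ A0set M N) :
    ∃ n : ℕ, 1 ≤ n ∧ Hfun x n = 0 := by
  obtain ⟨⟨j, hj1, hj⟩, -⟩ := hx.2 0
  refine ⟨j, hj1, ?_⟩
  rw [zero_add, Hfun_zero] at hj
  exact hj

end Final

/-- Proposition 2.5: for each `γ ∈ {α, β}`, `M^e_γ(Σ_D)` and `M^e_0(Σ_D)` are contained in
the weak* closure of `M^e_γ(Σ_D) ∩ M^{CO}(Σ_D)`; in particular `M^{CO}(Σ_D)` is dense in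
`M^e(Σ_D)`. -/
theorem CO_measures_dense (M N : ℕ) (hM : 2 ≤ M) :
    MeAl M N ⊆ closure (MeAl M N ∩ MCO M N) ∧
    MeBe M N ⊆ closure (MeBe M N ∩ MCO M N) ∧
    Me0 M N ⊆ closure (MeAl M N ∩ MCO M N) ∧
    Me0 M N ⊆ closure (MeBe M N ∩ MCO M N) ∧
    MergD M N ⊆ closure (MCO M N) := by
  refine ⟨fun μ hμ => ?_, fun μ hμ => ?_, fun μ hμ => ?_, fun μ hμ => ?_, fun μ hμ => ?_⟩
  · refine mem_closure_alpha hM hμ.1 (integral_Gr_nonneg hμ.1.toMeasurePreserving hμ.2 ?_)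
    intro x hx
    obtain ⟨n, h1, h2⟩ := ((eventually_ge_atTop 1).and
      ((hx.2.1.comp tendsto_natCast_atTop_atTop).eventually_ge_atTop 0)).exists
    exact ⟨n, h1, h2⟩
  · refine mem_closure_beta hM hμ.1 (integral_Gr_nonpos hμ.1.toMeasurePreserving hμ.2 ?_)
    intro x hx
    obtain ⟨n, h1, h2⟩ := ((eventually_ge_atTop 1).and
      ((hx.2.1.comp tendsto_natCast_atTop_atTop).eventually_le_atBot 0)).exists
    exact ⟨n, h1, h2⟩
  · refine mem_closure_alpha hM hμ.1 (integral_Gr_nonneg hμ.1.toMeasurePreserving hμ.2 ?_)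
    intro x hx
    obtain ⟨n, h1, h2⟩ := Me0_return hx
    exact ⟨n, h1, h2.ge⟩
  · refine mem_closure_beta hM hμ.1 (integral_Gr_nonpos hμ.1.toMeasurePreserving hμ.2 ?_)
    intro x hx
    obtain ⟨n, h1, h2⟩ := Me0_return hx
    exact ⟨n, h1, h2.le⟩
  · rcases le_total 0 (∫ x, Gr x ∂μ.toMeasure) with h | h
    · exact closure_mono Set.inter_subset_right (mem_closure_alpha hM hμ h)
    · exact closure_mono Set.inter_subset_right (mem_closure_beta hM hμ h)
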